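/- arXiv:1910.06927 — 2 statements merged into one kernel-verified Lean document; each statement's English description precedes it below -/
import Mathlib

section
/- Suppose u : [0,1] → ℝ is a Lebesgue-measurable function satisfying u(1-x) + (1-x) · u(y/(1-x)) = u(y) + (1-y) · u((1-x-y)/(1-y)) for all x, y ∈ [0,1) with x + y ≤ 1. Then there exists a real constant λ such that u(x) = λ · (−x·log₂ x − (1−x)·log₂(1−x)) for all x ∈ [0,1], with the convention 0·log₂ 0 = 0. -/
open MeasureTheory Set Filter Topology

/-- The function in odds coordinates. -/
noncomputable def hodds (u : ℝ → ℝ) (s : ℝ) : ℝ := (1 + s) * u (s / (1 + s))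

lemma hodds_eq (u : ℝ → ℝ)
    (heq : ∀ x y : ℝ, 0 ≤ x → x < 1 → 0 ≤ y → y < 1 → x + y ≤ 1 →
      u (1 - x) + (1 - x) * u (y / (1 - x))
        = u y + (1 - y) * u ((1 - x - y) / (1 - y)))
    {s y : ℝ} (hy : 0 < y) (hys : y < s) :
    hodds u s = (1 + s) * u (y / (1 + s)) + hodds u (s - y) - s * u (y / s) := by
  have hs : 0 < s := hy.trans hys
  have h1 : 0 < 1 + s := by linarith
  have h2 : 0 < 1 + (s - y) := by linarith
  have h := heq (1 / (1 + s)) (y / (1 + s)) (by positivity)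
    (by rw [div_lt_one h1]; linarith) (by positivity)
    (by rw [div_lt_one h1]; linarith)
    (by rw [← add_div, div_le_one h1]; linarith)
  have e1 : 1 - 1 / (1 + s) = s / (1 + s) := by field_simp; ring
  have e2 : y / (1 + s) / (s / (1 + s)) = y / s := by field_simp
  have e4 : 1 - y / (1 + s) = (1 + (s - y)) / (1 + s) := by field_simp; ring
  have e3 : (s / (1 + s) - y / (1 + s)) / ((1 + (s - y)) / (1 + s)) = (s - y) / (1 + (s - y)) := by
    field_simp
  rw [e1, e2, e4, e3] at h
  unfold hodds
  have h3 := congrArg (fun z => (1 + s) * z) h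
  simp only [mul_add] at h3
  have e5 : (1 + s) * (s / (1 + s) * u (y / s)) = s * u (y / s) := by field_simp
  have e6 : (1 + s) * ((1 + (s - y)) / (1 + s) * u ((s - y) / (1 + (s - y))))
     = (1 + (s - y)) * u ((s - y) / (1 + (s - y))) := by field_simp
  rw [e5, e6] at h3
  linarith

lemma hodds_meas {u : ℝ → ℝ} (hu : Measurable u) : Measurable (hodds u) := by
  unfold hodds
  fun_prop

lemma small_tail {f : ℝ → ℝ} (hf : Measurable f) (M : ℝ) {ε : ENNReal} (hε : 0 < ε) :
    ∃ N : ℕ, volume ({x | (N : ℝ) < |f x|} ∩ Ioo 0 M) < ε := by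
  have hm : ∀ N : ℕ, MeasurableSet ({x | (N : ℝ) < |f x|} ∩ Ioo 0 M) := fun N =>
    (measurableSet_lt measurable_const hf.abs).inter measurableSet_Ioo
  have h := tendsto_measure_iInter_atTop (μ := volume)
    (s := fun N : ℕ => {x | (N : ℝ) < |f x|} ∩ Ioo 0 M)
    (fun N => (hm N).nullMeasurableSet)
    (by
      intro m n hmn x hx
      refine ⟨?_, hx.2⟩
      have h1 : (n : ℝ) < |f x| := hx.1
      have h2 : (m : ℝ) ≤ n := by exact_mod_cast hmn
      exact lt_of_le_of_lt h2 h1)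
    ⟨0, (lt_of_le_of_lt (measure_mono inter_subset_right) (by simp [Real.volume_Ioo])).ne⟩
  have he : (⋂ N : ℕ, {x | (N : ℝ) < |f x|} ∩ Ioo 0 M) = ∅ := by
    ext x
    simp only [mem_iInter, mem_empty_iff_false, iff_false, not_forall]
    obtain ⟨n, hn⟩ := exists_nat_gt |f x|
    exact ⟨n, fun h => absurd h.1 (not_lt.mpr hn.le)⟩
  rw [he, measure_empty] at h
  exact (h.eventually_lt_const hε).exists

lemma hodds_bdd {u : ℝ → ℝ} (hu : Measurable u)
    (H : ∀ s y : ℝ, 0 < y → y < s →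
      hodds u s = (1 + s) * u (y / (1 + s)) + hodds u (s - y) - s * u (y / s))
    {a b : ℝ} (ha : 0 < a) (hab : a ≤ b) : ∃ C, ∀ s ∈ Icc a b, |hodds u s| ≤ C := by
  set δ : ℝ := a / (4 * (1 + b)) with hδ
  have hb : 0 < 1 + b := by linarith
  have hδ0 : 0 < δ := by positivity
  obtain ⟨N, hN⟩ := small_tail hu 1 (ENNReal.ofReal_pos.mpr hδ0)
  obtain ⟨K, hK⟩ := small_tail (hodds_meas hu) b (ENNReal.ofReal_pos.mpr hδ0)
  refine ⟨(1 + b) * N + K + b * N, fun s hs => ?_⟩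
  have hs0 : 0 < s := ha.trans_le hs.1
  have h1s : 0 < 1 + s := by linarith
  obtain ⟨y, hy, g1, g2, g3⟩ : ∃ y ∈ Ioo 0 s, |u (y / (1 + s))| ≤ N ∧ |hodds u (s - y)| ≤ K ∧
      |u (y / s)| ≤ N := by
    by_contra! hcon
    set E := {x | (N : ℝ) < |u x|} ∩ Ioo 0 1
    set F := {x | (K : ℝ) < |hodds u x|} ∩ Ioo 0 b
    have hsub : Ioo 0 s ⊆ ((fun y => y * (1 + s)⁻¹) ⁻¹' E ∪ (fun y => s - y) ⁻¹' F) ∪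
        (fun y => y * s⁻¹) ⁻¹' E := by
      intro y hy
      by_cases c1 : |u (y / (1 + s))| ≤ N
      · by_cases c2 : |hodds u (s - y)| ≤ K
        · right
          refine ⟨by simpa [div_eq_mul_inv] using hcon y hy c1 c2, ?_⟩
          show y * s⁻¹ ∈ Ioo (0:ℝ) 1
          rw [← div_eq_mul_inv]
          exact ⟨div_pos hy.1 hs0, (div_lt_one hs0).mpr hy.2⟩
        · left; right
          exact ⟨not_le.mp c2, by constructor <;> linarith [hy.1, hy.2, hs.2]⟩
      · left; left
        refine ⟨by simpa [div_eq_mul_inv] using c1, ?_⟩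
        show y * (1 + s)⁻¹ ∈ Ioo (0:ℝ) 1
        rw [← div_eq_mul_inv]
        exact ⟨div_pos hy.1 h1s, (div_lt_one h1s).mpr (by linarith [hy.2])⟩
    have hvol := (measure_mono (μ := volume) hsub).trans
      ((measure_union_le _ _).trans (add_le_add_left (measure_union_le _ _) _))
    have hF : MeasurableSet F :=
      (measurableSet_lt measurable_const (hodds_meas hu).abs).inter measurableSet_Ioo
    have hpre : volume ((fun y => s - y) ⁻¹' F) = volume F :=
      (Measure.measurePreserving_sub_left volume s).measure_preimage hF.nullMeasurableSet
    rw [Real.volume_Ioo, Real.volume_preimage_mul_right (by positivity),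
      Real.volume_preimage_mul_right (by positivity), hpre, inv_inv, inv_inv,
      abs_of_pos h1s, abs_of_pos hs0] at hvol
    have h2 : ENNReal.ofReal (s - 0) ≤ ENNReal.ofReal ((1 + s) * δ + δ + s * δ) := by
      refine hvol.trans ?_
      rw [ENNReal.ofReal_add (p := (1 + s) * δ + δ) (by positivity) (by positivity),
        ENNReal.ofReal_add (p := (1 + s) * δ) (by positivity) (by positivity),
        ENNReal.ofReal_mul h1s.le, ENNReal.ofReal_mul hs0.le]
      gcongr
    rw [ENNReal.ofReal_le_ofReal_iff (by positivity)] at h2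
    have h3 : 4 * ((1 + b) * δ) = a := by rw [hδ]; field_simp
    nlinarith [hs.1, hs.2, mul_le_mul_of_nonneg_right hs.2 hδ0.le]
  rw [H s y hy.1 hy.2]
  calc _ ≤ |(1 + s) * u (y / (1 + s))| + |hodds u (s - y)| + |s * u (y / s)| :=
        (abs_sub _ _).trans (by gcongr; exact abs_add_le _ _)
    _ ≤ _ := by
      rw [abs_mul, abs_mul, abs_of_pos h1s, abs_of_pos hs0]
      have := hs.2
      have hb0 : 0 ≤ b := by linarith
      gcongr

lemma u_bdd {u : ℝ → ℝ} (hu : Measurable u)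
    (H : ∀ s y : ℝ, 0 < y → y < s →
      hodds u s = (1 + s) * u (y / (1 + s)) + hodds u (s - y) - s * u (y / s))
    {a b : ℝ} (ha : 0 < a) (hab : a ≤ b) (hb : b < 1) : ∃ C, ∀ p ∈ Icc a b, |u p| ≤ C := by
  have hb0 : 0 < 1 - b := by linarith
  obtain ⟨C, hC⟩ := hodds_bdd hu H ha (b := b / (1 - b))
    (by rw [le_div_iff₀ hb0]; nlinarith)
  refine ⟨C, fun p hp => ?_⟩
  have hp1 : 0 < 1 - p := by linarith [hp.2]
  have hp0 : 0 < p := by linarith [hp.1]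
  have h := hC (p / (1 - p)) ⟨by rw [le_div_iff₀ hp1]; nlinarith [hp.1], by
    rw [div_le_div_iff₀ hp1 hb0]; nlinarith [hp.2]⟩
  have e : 1 + p / (1 - p) = 1 / (1 - p) := by field_simp; ring
  have e2 : p / (1 - p) / (1 / (1 - p)) = p := by field_simp
  unfold hodds at h
  rw [e, e2, abs_mul, abs_of_pos (by positivity)] at h
  refine le_trans ?_ h
  refine le_mul_of_one_le_left (abs_nonneg _) ?_
  rw [le_div_iff₀ hp1]; linarith

lemma ii_of_bdd {f : ℝ → ℝ} (hf : Measurable f) {l r : ℝ} {I : Set ℝ} (_hI : I.OrdConnected)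
    (hb : ∀ a ∈ I, ∀ b ∈ I, a ≤ b → ∃ C, ∀ p ∈ Icc a b, |f p| ≤ C) (hl : l ∈ I) (hr : r ∈ I) :
    IntervalIntegrable f volume l r := by
  wlog hlr : l ≤ r generalizing l r
  · exact (this hr hl (le_of_not_ge hlr)).symm
  obtain ⟨C, hC⟩ := hb l hl r hr hlr
  rw [intervalIntegrable_iff_integrableOn_Icc_of_le hlr]
  exact Measure.integrableOn_of_bounded (M := C) (by simp) hf.aestronglyMeasurable
    ((ae_restrict_iff' measurableSet_Icc).mpr (Eventually.of_forall hC))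

lemma prim_cont {f : ℝ → ℝ} (hf : Measurable f) {x0 : ℝ} {I : Set ℝ} (hI : I.OrdConnected)
    (hIo : IsOpen I)
    (hb : ∀ a ∈ I, ∀ b ∈ I, a ≤ b → ∃ C, ∀ p ∈ Icc a b, |f p| ≤ C) (hx0 : x0 ∈ I)
    {x : ℝ} (hx : x ∈ I) : ContinuousAt (fun t => ∫ w in x0..t, f w) x := by
  obtain ⟨ε, hε, hball⟩ := Metric.isOpen_iff.mp hIo x hx
  rw [Real.ball_eq_Ioo] at hball
  have hl : x - ε/2 ∈ I := hball ⟨by linarith, by linarith⟩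
  have hr : x + ε/2 ∈ I := hball ⟨by linarith, by linarith⟩
  have hc := intervalIntegral.continuousOn_primitive_interval' (a := x0)
    (b₁ := min x0 (x - ε/2)) (b₂ := max x0 (x + ε/2)) (f := f) (μ := volume)
    (ii_of_bdd hf hI hb (by rcases min_choice x0 (x - ε/2) with h | h <;> rw [h] <;> assumption)
      (by rcases max_choice x0 (x + ε/2) with h | h <;> rw [h] <;> assumption))
    (by rw [uIcc_of_le (by simp)]; simp)
  refine hc.continuousAt ?_
  rw [uIcc_of_le (by simp)]
  exact Icc_mem_nhds (min_lt_of_right_lt (by linarith)) (lt_max_of_lt_right (by linarith))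

lemma prim_diff {f : ℝ → ℝ} (hf : Measurable f) {x0 : ℝ} {I : Set ℝ} (hI : I.OrdConnected)
    (hb : ∀ a ∈ I, ∀ b ∈ I, a ≤ b → ∃ C, ∀ p ∈ Icc a b, |f p| ≤ C) (hx0 : x0 ∈ I)
    {x : ℝ} (hx : x ∈ I) (hc : ContinuousAt f x) :
    DifferentiableAt ℝ (fun t => ∫ w in x0..t, f w) x :=
  (intervalIntegral.integral_hasDerivAt_right (ii_of_bdd hf hI hb hx0 hx)
    (hf.stronglyMeasurable.stronglyMeasurableAtFilter) hc).differentiableAt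

lemma hodds_formula {u : ℝ → ℝ} (hu : Measurable u)
    (H : ∀ s y : ℝ, 0 < y → y < s →
      hodds u s = (1 + s) * u (y / (1 + s)) + hodds u (s - y) - s * u (y / s))
    {c d s : ℝ} (hc : 0 < c) (hcd : c < d) (hd : d < s) :
    hodds u s = ((1 + s) ^ 2 * ((∫ w in (1/2)..(d / (1 + s)), u w) - ∫ w in (1/2)..(c / (1 + s)), u w)
      + ((∫ w in 1..(s - c), hodds u w) - ∫ w in 1..(s - d), hodds u w)
      - s ^ 2 * ((∫ w in (1/2)..(d / s), u w) - ∫ w in (1/2)..(c / s), u w)) / (d - c) := by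
  have hs : 0 < s := by linarith
  have h1s : 0 < 1 + s := by linarith
  have hd0 : 0 < d := by linarith
  have iu : ∀ l ∈ Ioo (0:ℝ) 1, ∀ r ∈ Ioo (0:ℝ) 1, IntervalIntegrable u volume l r :=
    fun l hl r hr => ii_of_bdd hu ordConnected_Ioo
      (fun a ha b hb hab => u_bdd hu H ha.1 hab hb.2) hl hr
  have ih : ∀ l ∈ Ioi (0:ℝ), ∀ r ∈ Ioi (0:ℝ), IntervalIntegrable (hodds u) volume l r :=
    fun l hl r hr => ii_of_bdd (hodds_meas hu) ordConnected_Ioi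
      (fun a ha b hb hab => hodds_bdd hu H ha hab) hl hr
  have m0 : (1/2 : ℝ) ∈ Ioo (0:ℝ) 1 := by norm_num
  have m1 : d / (1 + s) ∈ Ioo (0:ℝ) 1 := ⟨by positivity, by rw [div_lt_one h1s]; linarith⟩
  have m2 : c / (1 + s) ∈ Ioo (0:ℝ) 1 := ⟨by positivity, by rw [div_lt_one h1s]; linarith⟩
  have m3 : d / s ∈ Ioo (0:ℝ) 1 := ⟨by positivity, by rw [div_lt_one hs]; linarith⟩
  have m4 : c / s ∈ Ioo (0:ℝ) 1 := ⟨by positivity, by rw [div_lt_one hs]; linarith⟩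
  have m5 : s - c ∈ Ioi (0:ℝ) := by simp; linarith
  have m6 : s - d ∈ Ioi (0:ℝ) := by simp; linarith
  have m7 : (1:ℝ) ∈ Ioi (0:ℝ) := by simp
  rw [intervalIntegral.integral_interval_sub_left (iu _ m0 _ m1) (iu _ m0 _ m2),
    intervalIntegral.integral_interval_sub_left (iu _ m0 _ m3) (iu _ m0 _ m4),
    intervalIntegral.integral_interval_sub_left (ih _ m7 _ m5) (ih _ m7 _ m6)]
  have k1 : ∫ y in c..d, (1 + s) * u (y / (1 + s)) = (1 + s) ^ 2 * ∫ w in (c / (1 + s))..(d / (1 + s)), u w := by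
    rw [intervalIntegral.integral_const_mul, intervalIntegral.integral_comp_div _ h1s.ne', smul_eq_mul]
    ring
  have k2 : ∫ y in c..d, s * u (y / s) = s ^ 2 * ∫ w in (c / s)..(d / s), u w := by
    rw [intervalIntegral.integral_const_mul, intervalIntegral.integral_comp_div _ hs.ne', smul_eq_mul]
    ring
  have k3 : ∫ y in c..d, hodds u (s - y) = ∫ w in (s - d)..(s - c), hodds u w :=
    intervalIntegral.integral_comp_sub_left _ _
  have j1 : IntervalIntegrable (fun y => (1 + s) * u (y / (1 + s))) volume c d := by
    have := ((iu _ m2 _ m1).comp_mul_right (c := (1 + s)⁻¹)).const_mul (1 + s)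
    simpa [div_eq_mul_inv, h1s.ne'] using this
  have j2 : IntervalIntegrable (fun y => s * u (y / s)) volume c d := by
    have := ((iu _ m4 _ m3).comp_mul_right (c := s⁻¹)).const_mul s
    simpa [div_eq_mul_inv, hs.ne'] using this
  have j3 : IntervalIntegrable (fun y => hodds u (s - y)) volume c d := by
    have := (ih _ m5 _ m6).comp_sub_left s
    simpa using this
  have k : ∫ y in c..d, hodds u s = ∫ y in c..d, ((1 + s) * u (y / (1 + s)) + hodds u (s - y) - s * u (y / s)) := by
    refine intervalIntegral.integral_congr fun y hy => ?_
    rw [uIcc_of_le hcd.le] at hy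
    exact H s y (by linarith [hy.1]) (by linarith [hy.2])
  rw [intervalIntegral.integral_sub (j1.add j3) j2, intervalIntegral.integral_add j1 j3, k1, k2, k3,
    intervalIntegral.integral_const, smul_eq_mul] at k
  rw [eq_div_iff (by linarith), mul_comm, k]

lemma u_eq_hodds (u : ℝ → ℝ) {p : ℝ} (hp : p < 1) : u p = (1 - p) * hodds u (p / (1 - p)) := by
  have hp1 : 0 < 1 - p := by linarith
  have e : 1 + p / (1 - p) = 1 / (1 - p) := by field_simp; ring
  have e2 : p / (1 - p) / (1 / (1 - p)) = p := by field_simp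
  unfold hodds
  rw [e, e2]; field_simp

lemma hodds_formula_ev {u : ℝ → ℝ} (hu : Measurable u)
    (H : ∀ s y : ℝ, 0 < y → y < s →
      hodds u s = (1 + s) * u (y / (1 + s)) + hodds u (s - y) - s * u (y / s))
    {s0 : ℝ} (hs : 0 < s0) : ∃ c d, 0 < c ∧ c < d ∧ d < s0 ∧
    hodds u =ᶠ[𝓝 s0] fun s => ((1 + s) ^ 2 * ((∫ w in (1/2)..(d / (1 + s)), u w) - ∫ w in (1/2)..(c / (1 + s)), u w)
      + ((∫ w in 1..(s - c), hodds u w) - ∫ w in 1..(s - d), hodds u w)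
      - s ^ 2 * ((∫ w in (1/2)..(d / s), u w) - ∫ w in (1/2)..(c / s), u w)) / (d - c) := by
  refine ⟨s0/4, s0/2, by linarith, by linarith, by linarith, ?_⟩
  filter_upwards [Ioi_mem_nhds (show s0/2 < s0 by linarith)] with s hs'
  exact hodds_formula hu H (by linarith) (by linarith) hs'

lemma hodds_cont {u : ℝ → ℝ} (hu : Measurable u)
    (H : ∀ s y : ℝ, 0 < y → y < s →
      hodds u s = (1 + s) * u (y / (1 + s)) + hodds u (s - y) - s * u (y / s))
    {s : ℝ} (hs : 0 < s) : ContinuousAt (hodds u) s := by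
  obtain ⟨c, d, hc, hcd, hd, hev⟩ := hodds_formula_ev hu H hs
  refine ContinuousAt.congr ?_ hev.symm
  have h1s : 0 < 1 + s := by linarith
  have hd0 : 0 < d := by linarith
  have m0 : (1/2 : ℝ) ∈ Ioo (0:ℝ) 1 := by norm_num
  have m1 : d / (1 + s) ∈ Ioo (0:ℝ) 1 := ⟨by positivity, by rw [div_lt_one h1s]; linarith⟩
  have m2 : c / (1 + s) ∈ Ioo (0:ℝ) 1 := ⟨by positivity, by rw [div_lt_one h1s]; linarith⟩
  have m3 : d / s ∈ Ioo (0:ℝ) 1 := ⟨by positivity, by rw [div_lt_one hs]; linarith⟩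
  have m4 : c / s ∈ Ioo (0:ℝ) 1 := ⟨by positivity, by rw [div_lt_one hs]; linarith⟩
  have m5 : s - c ∈ Ioi (0:ℝ) := by simp; linarith
  have m6 : s - d ∈ Ioi (0:ℝ) := by simp; linarith
  have m7 : (1:ℝ) ∈ Ioi (0:ℝ) := by simp
  have cu : ∀ x ∈ Ioo (0:ℝ) 1, ContinuousAt (fun t => ∫ w in (1/2)..t, u w) x := fun x hx =>
    prim_cont hu ordConnected_Ioo isOpen_Ioo
      (fun a ha b hb hab => u_bdd hu H ha.1 hab hb.2) m0 hx
  have ch : ∀ x ∈ Ioi (0:ℝ), ContinuousAt (fun t => ∫ w in 1..t, hodds u w) x := fun x hx =>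
    prim_cont (hodds_meas hu) ordConnected_Ioi isOpen_Ioi
      (fun a ha b hb hab => hodds_bdd hu H ha hab) m7 hx
  have t1 := ContinuousAt.comp' (f := fun s => d / (1 + s)) (cu _ m1) (by fun_prop (disch := positivity))
  have t2 := ContinuousAt.comp' (f := fun s => c / (1 + s)) (cu _ m2) (by fun_prop (disch := positivity))
  have t3 := ContinuousAt.comp' (f := fun s => d / s) (cu _ m3) (by fun_prop (disch := positivity))
  have t4 := ContinuousAt.comp' (f := fun s => c / s) (cu _ m4) (by fun_prop (disch := positivity))
  have t5 := ContinuousAt.comp' (f := fun s => s - c) (ch _ m5) (by fun_prop)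
  have t6 := ContinuousAt.comp' (f := fun s => s - d) (ch _ m6) (by fun_prop)
  exact (((((continuousAt_const.add continuousAt_id).pow 2).mul (t1.sub t2)).add (t5.sub t6)).sub
    ((continuousAt_id.pow 2).mul (t3.sub t4))).div_const _

lemma u_cont {u : ℝ → ℝ} (hu : Measurable u)
    (H : ∀ s y : ℝ, 0 < y → y < s →
      hodds u s = (1 + s) * u (y / (1 + s)) + hodds u (s - y) - s * u (y / s))
    {p : ℝ} (hp : p ∈ Ioo (0:ℝ) 1) : ContinuousAt u p := by
  have hp1 : 0 < 1 - p := by linarith [hp.2]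
  have hev : u =ᶠ[𝓝 p] fun p => (1 - p) * hodds u (p / (1 - p)) := by
    filter_upwards [Iio_mem_nhds hp.2] with q hq using u_eq_hodds u hq
  refine ContinuousAt.congr ?_ hev.symm
  have t := ContinuousAt.comp' (f := fun p : ℝ => p / (1 - p)) (hodds_cont hu H (div_pos hp.1 hp1))
    (by fun_prop (disch := positivity))
  exact (continuousAt_const.sub continuousAt_id).mul t

lemma hodds_diff {u : ℝ → ℝ} (hu : Measurable u)
    (H : ∀ s y : ℝ, 0 < y → y < s →
      hodds u s = (1 + s) * u (y / (1 + s)) + hodds u (s - y) - s * u (y / s))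
    {s : ℝ} (hs : 0 < s) : DifferentiableAt ℝ (hodds u) s := by
  obtain ⟨c, d, hc, hcd, hd, hev⟩ := hodds_formula_ev hu H hs
  refine DifferentiableAt.congr_of_eventuallyEq ?_ hev
  have h1s : 0 < 1 + s := by linarith
  have hd0 : 0 < d := by linarith
  have m0 : (1/2 : ℝ) ∈ Ioo (0:ℝ) 1 := by norm_num
  have m1 : d / (1 + s) ∈ Ioo (0:ℝ) 1 := ⟨by positivity, by rw [div_lt_one h1s]; linarith⟩
  have m2 : c / (1 + s) ∈ Ioo (0:ℝ) 1 := ⟨by positivity, by rw [div_lt_one h1s]; linarith⟩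
  have m3 : d / s ∈ Ioo (0:ℝ) 1 := ⟨by positivity, by rw [div_lt_one hs]; linarith⟩
  have m4 : c / s ∈ Ioo (0:ℝ) 1 := ⟨by positivity, by rw [div_lt_one hs]; linarith⟩
  have m5 : s - c ∈ Ioi (0:ℝ) := by simp; linarith
  have m6 : s - d ∈ Ioi (0:ℝ) := by simp; linarith
  have m7 : (1:ℝ) ∈ Ioi (0:ℝ) := by simp
  have cu : ∀ x ∈ Ioo (0:ℝ) 1, DifferentiableAt ℝ (fun t => ∫ w in (1/2)..t, u w) x := fun x hx =>
    prim_diff hu ordConnected_Ioo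
      (fun a ha b hb hab => u_bdd hu H ha.1 hab hb.2) m0 hx (u_cont hu H hx)
  have ch : ∀ x ∈ Ioi (0:ℝ), DifferentiableAt ℝ (fun t => ∫ w in 1..t, hodds u w) x := fun x hx =>
    prim_diff (hodds_meas hu) ordConnected_Ioi
      (fun a ha b hb hab => hodds_bdd hu H ha hab) m7 hx (hodds_cont hu H hx)
  have t1 := DifferentiableAt.fun_comp' (f := fun s => d / (1 + s)) s (cu _ m1) (by fun_prop (disch := positivity))
  have t2 := DifferentiableAt.fun_comp' (f := fun s => c / (1 + s)) s (cu _ m2) (by fun_prop (disch := positivity))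
  have t3 := DifferentiableAt.fun_comp' (f := fun s => d / s) s (cu _ m3) (by fun_prop (disch := positivity))
  have t4 := DifferentiableAt.fun_comp' (f := fun s => c / s) s (cu _ m4) (by fun_prop (disch := positivity))
  have t5 := DifferentiableAt.fun_comp' (f := fun s => s - c) s (ch _ m5) (by fun_prop)
  have t6 := DifferentiableAt.fun_comp' (f := fun s => s - d) s (ch _ m6) (by fun_prop)
  exact ((((((differentiableAt_const _).add differentiableAt_id).pow 2).mul (t1.sub t2)).add (t5.sub t6)).sub
    ((differentiableAt_id.pow 2).mul (t3.sub t4))).div_const _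

lemma u_diff {u : ℝ → ℝ} (hu : Measurable u)
    (H : ∀ s y : ℝ, 0 < y → y < s →
      hodds u s = (1 + s) * u (y / (1 + s)) + hodds u (s - y) - s * u (y / s))
    {p : ℝ} (hp : p ∈ Ioo (0:ℝ) 1) : DifferentiableAt ℝ u p := by
  have hp1 : 0 < 1 - p := by linarith [hp.2]
  have hev : u =ᶠ[𝓝 p] fun p => (1 - p) * hodds u (p / (1 - p)) := by
    filter_upwards [Iio_mem_nhds hp.2] with q hq using u_eq_hodds u hq
  refine DifferentiableAt.congr_of_eventuallyEq ?_ hev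
  have t := DifferentiableAt.fun_comp' (f := fun p : ℝ => p / (1 - p)) p (hodds_diff hu H (div_pos hp.1 hp1))
    (by fun_prop (disch := positivity))
  exact ((differentiableAt_const _).sub differentiableAt_id).mul t

lemma dderiv_eq {u : ℝ → ℝ} (hd : ∀ p ∈ Ioo (0:ℝ) 1, DifferentiableAt ℝ u p)
    (heq : ∀ x y : ℝ, 0 ≤ x → x < 1 → 0 ≤ y → y < 1 → x + y ≤ 1 →
      u (1 - x) + (1 - x) * u (y / (1 - x))
        = u y + (1 - y) * u ((1 - x - y) / (1 - y)))
    {p y : ℝ} (hy : 0 < y) (hyp : y < p) (hp : p < 1) :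
    deriv u p = deriv u ((p - y) / (1 - y)) - u (y / p) + (y / p) * deriv u (y / p) := by
  have hp0 : 0 < p := hy.trans hyp
  have hy1 : 0 < 1 - y := by linarith
  have hev : (fun p => u p) =ᶠ[𝓝 p] fun p => u y + (1 - y) * u ((p - y) / (1 - y)) - p * u (y / p) := by
    filter_upwards [Ioo_mem_nhds hyp hp] with q hq
    have h := heq (1 - q) y (by linarith [hq.2]) (by linarith [hq.1]) hy.le (by linarith)
      (by linarith [hq.1])
    simp only [sub_sub_cancel] at h
    linarith
  have d1 : HasDerivAt u (deriv u ((p - y) / (1 - y))) ((p - y) / (1 - y)) :=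
    (hd _ ⟨div_pos (by linarith) hy1, by rw [div_lt_one hy1]; linarith⟩).hasDerivAt
  have d2 : HasDerivAt u (deriv u (y / p)) (y / p) :=
    (hd _ ⟨div_pos hy hp0, by rw [div_lt_one hp0]; linarith⟩).hasDerivAt
  have e1 : HasDerivAt (fun p => (p - y) / (1 - y)) (1 / (1 - y)) p :=
    ((hasDerivAt_id p).sub_const y).div_const _
  have e2 : HasDerivAt (fun p => y / p) (-y / p ^ 2) p := by
    have := (hasDerivAt_const p y).div (hasDerivAt_id p) hp0.ne'
    simp only [zero_mul, mul_one, zero_sub, id] at this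
    exact this
  have f1 := d1.comp p e1
  have f2 := d2.comp p e2
  have g := ((f1.const_mul (1 - y)).const_add (u y)).sub ((hasDerivAt_id p).mul f2)
  have g2 := (g.congr_of_eventuallyEq hev).deriv
  rw [g2]
  simp only [Function.comp, id]
  field_simp
  ring

lemma odds_additive {u : ℝ → ℝ} (hd : ∀ p ∈ Ioo (0:ℝ) 1, DifferentiableAt ℝ u p)
    (heq : ∀ x y : ℝ, 0 ≤ x → x < 1 → 0 ≤ y → y < 1 → x + y ≤ 1 →
      u (1 - x) + (1 - x) * u (y / (1 - x))
        = u y + (1 - y) * u ((1 - x - y) / (1 - y))) :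
    ∃ a b : ℝ, ∀ p ∈ Ioo (0:ℝ) 1, deriv u p = a * (Real.log p - Real.log (1 - p)) + b := by
  set L : ℝ → ℝ := fun s => deriv u (Real.exp s / (1 + Real.exp s)) with hL
  have hK : ∃ K : ℝ → ℝ, ∀ s r, 0 < r → L (s + r) - L s = K r := by
    refine ⟨fun r => (1 - Real.exp (-r)) * deriv u (1 - Real.exp (-r)) - u (1 - Real.exp (-r)),
      fun s r hr => ?_⟩
    set P := Real.exp (s + r) with hP
    set e := Real.exp (-r) with he
    have hP0 : 0 < P := Real.exp_pos _
    have he0 : 0 < e := Real.exp_pos _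
    have he1 : e < 1 := by rw [he, Real.exp_lt_one_iff]; linarith
    have hPe : Real.exp s = P * e := by rw [hP, he, ← Real.exp_add]; ring_nf
    have ht : 0 < 1 - e := by linarith
    have hp0 : 0 < P / (1 + P) := by positivity
    have h := dderiv_eq hd heq (p := P / (1 + P)) (y := P / (1 + P) * (1 - e)) (by positivity)
      (by nlinarith) (by rw [div_lt_one (by positivity)]; linarith)
    have h2 : P / (1 + P) * (1 - e) / (P / (1 + P)) = 1 - e := by field_simp
    have h4 : 1 - P / (1 + P) * (1 - e) = (1 + P * e) / (1 + P) := by field_simp; ring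
    have h3 : (P / (1 + P) - P / (1 + P) * (1 - e)) / (1 - P / (1 + P) * (1 - e))
        = P * e / (1 + P * e) := by
      rw [h4]; field_simp; ring
    rw [h2, h3] at h
    simp only [hL, hPe, ← hP]
    linarith
  obtain ⟨K, hK⟩ := hK
  have hK' : ∀ s r, 0 < r → L (s + r) - L s = L r - L 0 := fun s r hr => by
    rw [hK s r hr, ← hK 0 r hr, zero_add]
  have hadd : ∀ s r, L (s + r) - L 0 = (L s - L 0) + (L r - L 0) := by
    intro s r
    rcases lt_trichotomy r 0 with h | h | h
    · have h1 := hK' (s + r) (-r) (by linarith)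
      have h2 := hK' r (-r) (by linarith)
      simp only [add_neg_cancel, add_neg_cancel_right] at h1 h2
      linarith
    · subst h; simp
    · linarith [hK' s r h]
  let A : ℝ →+ ℝ := AddMonoidHom.mk' (fun s => L s - L 0) hadd
  have hLm : Measurable L := (measurable_deriv u).comp (by fun_prop)
  have hA : Continuous A := MeasureTheory.Measure.AddMonoidHom.continuous_of_measurable A (hLm.sub_const _)
  have hlin : ∀ s, L s - L 0 = s * (L 1 - L 0) := by
    intro s
    have := map_real_smul A hA s 1
    simpa [A] using this
  refine ⟨L 1 - L 0, L 0, fun p hp => ?_⟩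
  have hp1 : 0 < 1 - p := by linarith [hp.2]
  have h := hlin (Real.log p - Real.log (1 - p))
  have h5 : L (Real.log p - Real.log (1 - p)) = deriv u p := by
    simp only [hL]
    rw [Real.exp_sub, Real.exp_log hp.1, Real.exp_log hp1]
    congr 1
    field_simp
    ring
  rw [h5] at h
  linarith

lemma ent_deriv {p : ℝ} (hp : p ∈ Ioo (0:ℝ) 1) :
    HasDerivAt (fun p => p * Real.log p + (1 - p) * Real.log (1 - p))
      (Real.log p - Real.log (1 - p)) p := by
  have hp1 : 1 - p ≠ 0 := by linarith [hp.2]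
  have h1 := Real.hasDerivAt_mul_log hp.1.ne'
  have h2 := (Real.hasDerivAt_mul_log hp1).comp p ((hasDerivAt_id p).const_sub 1)
  have h3 := h1.add h2
  have e : Real.log p + 1 + (Real.log (1 - p) + 1) * (-1) = Real.log p - Real.log (1 - p) := by ring
  exact e ▸ h3

lemma core (u : ℝ → ℝ) (hu : Measurable u)
    (heq : ∀ x y : ℝ, 0 ≤ x → x < 1 → 0 ≤ y → y < 1 → x + y ≤ 1 →
      u (1 - x) + (1 - x) * u (y / (1 - x))
        = u y + (1 - y) * u ((1 - x - y) / (1 - y))) :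
    ∃ lam : ℝ, ∀ x : ℝ, 0 ≤ x → x ≤ 1 →
      u x = lam * (-(x * Real.logb 2 x) - (1 - x) * Real.logb 2 (1 - x)) := by
  have H : ∀ s y : ℝ, 0 < y → y < s →
      hodds u s = (1 + s) * u (y / (1 + s)) + hodds u (s - y) - s * u (y / s) :=
    fun s y hy hys => hodds_eq u heq hy hys
  have hd : ∀ p ∈ Ioo (0:ℝ) 1, DifferentiableAt ℝ u p := fun p hp => u_diff hu H hp
  obtain ⟨a, b, hab⟩ := odds_additive hd heq
  have hg : ∀ p ∈ Ioo (0:ℝ) 1, HasDerivAt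
      (fun p => u p - a * (p * Real.log p + (1 - p) * Real.log (1 - p)) - b * p) 0 p := by
    intro p hp
    have h := (((hd p hp).hasDerivAt).sub ((ent_deriv hp).const_mul a)).sub
      ((hasDerivAt_id p).const_mul b)
    have e : deriv u p - a * (Real.log p - Real.log (1 - p)) - b * 1 = 0 := by
      rw [hab p hp]; ring
    exact e ▸ h
  obtain ⟨c, hc⟩ := isOpen_Ioo.exists_is_const_of_deriv_eq_zero (isPreconnected_Ioo)
    (fun p hp => (hg p hp).differentiableAt.differentiableWithinAt) (fun p hp => (hg p hp).deriv)
  have hform : ∀ p ∈ Ioo (0:ℝ) 1,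
      u p = a * (p * Real.log p + (1 - p) * Real.log (1 - p)) + b * p + c := by
    intro p hp
    have := hc p hp
    linarith
  have l4 : Real.log (1/4) = -2 * Real.log 2 := by
    rw [show (1/4:ℝ) = (2 ^ 2)⁻¹ by norm_num, Real.log_inv, Real.log_pow]; push_cast; ring
  have l2 : Real.log (1/2) = -Real.log 2 := by
    rw [show (1/2:ℝ) = (2)⁻¹ by norm_num, Real.log_inv]
  have l3 : Real.log (1/3) = -Real.log 3 := by
    rw [show (1/3:ℝ) = (3)⁻¹ by norm_num, Real.log_inv]
  have l23 : Real.log (2/3) = Real.log 2 - Real.log 3 := Real.log_div (by norm_num) (by norm_num)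
  have l34 : Real.log (3/4) = Real.log 3 - 2 * Real.log 2 := by
    rw [Real.log_div (by norm_num) (by norm_num), show (4:ℝ) = 2 ^ 2 by norm_num, Real.log_pow]
    push_cast; ring
  have f4 := hform (1/4) (by norm_num)
  have f2 := hform (1/2) (by norm_num)
  have f3 := hform (1/3) (by norm_num)
  have f23 := hform (2/3) (by norm_num)
  have f34 := hform (3/4) (by norm_num)
  norm_num only at f4 f2 f3 f23 f34
  rw [l4, l34] at f4 f34
  rw [l2] at f2
  rw [l3, l23] at f3 f23
  have q1 := heq (1/4) (1/4) (by norm_num) (by norm_num) (by norm_num) (by norm_num) (by norm_num)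
  have q2 := heq (1/2) (1/4) (by norm_num) (by norm_num) (by norm_num) (by norm_num) (by norm_num)
  norm_num only at q1 q2
  rw [f34, f3, f4, f23] at q1
  rw [f2, f4, f3] at q2
  have hb : b = 0 := by linarith
  have hc0 : c = 0 := by rw [hb] at q2; linarith
  have u0 : u 0 = 0 := by
    have := heq (1/2) 0 (by norm_num) (by norm_num) (by norm_num) (by norm_num) (by norm_num)
    norm_num at this
    linarith
  have u1 : u 1 = 0 := by
    have := heq 0 (1/2) (by norm_num) (by norm_num) (by norm_num) (by norm_num) (by norm_num)
    norm_num at this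
    linarith
  refine ⟨-a * Real.log 2, fun x hx0 hx1 => ?_⟩
  rcases hx0.eq_or_lt with h | h
  · subst h; simp [u0]
  rcases hx1.eq_or_lt with h' | h'
  · subst h'; simp [u1]
  rw [hform x ⟨h, h'⟩, hb, hc0]
  have : Real.log 2 ≠ 0 := (Real.log_pos (by norm_num)).ne'
  unfold Real.logb
  field_simp
  ring

/-- For `α = 1`, any Lebesgue-measurable `u : [0,1] → ℝ` satisfying the fundamental
functional equation is a multiple of `s₁(x) = -x log₂ x - (1-x) log₂ (1-x)` (with `0 log₂ 0 = 0`,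
which is automatic since `Real.logb 2 0 = 0`). -/
theorem stmt1 (u : ℝ → ℝ)
    (hmeas : Measurable fun x : Set.Icc (0 : ℝ) 1 => u x)
    (heq : ∀ x y : ℝ, 0 ≤ x → x < 1 → 0 ≤ y → y < 1 → x + y ≤ 1 →
      u (1 - x) + (1 - x) * u (y / (1 - x))
        = u y + (1 - y) * u ((1 - x - y) / (1 - y))) :
    ∃ lam : ℝ, ∀ x : ℝ, 0 ≤ x → x ≤ 1 →
      u x = lam * (-(x * Real.logb 2 x) - (1 - x) * Real.logb 2 (1 - x)) := by
  set v : ℝ → ℝ := fun x => if h : x ∈ Set.Icc (0 : ℝ) 1 then u x else 0 with hv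
  have hvm : Measurable v := by
    refine Measurable.dite (s := Set.Icc (0 : ℝ) 1) (f := fun x => u x) (g := fun _ => 0) hmeas measurable_const
      measurableSet_Icc
  have hvu : ∀ x, 0 ≤ x → x ≤ 1 → v x = u x := fun x h0 h1 => by
    simp only [hv]; rw [dif_pos ⟨h0, h1⟩]
  obtain ⟨lam, hlam⟩ := core v hvm (by
    intro x y hx0 hx1 hy0 hy1 hxy
    have hx : 0 < 1 - x := by linarith
    have hy : 0 < 1 - y := by linarith
    rw [hvu _ hx.le (by linarith), hvu _ hy0 hy1.le,
      hvu _ (by positivity) (by rw [div_le_one hx]; linarith),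
      hvu _ (div_nonneg (by linarith) hy.le) (by rw [div_le_one hy]; linarith)]
    exact heq x y hx0 hx1 hy0 hy1 hxy)
  exact ⟨lam, fun x h0 h1 => by rw [← hvu x h0 h1]; exact hlam x h0 h1⟩
end

section
/- Let α > 0. Any Lebesgue-measurable function u : [0,1] → ℝ satisfying u(1-x) + (1-x)^α · u(y/(1-x)) = u(y) + (1-y)^α · u((1-x-y)/(1-y)) for all x, y ∈ [0,1) with x + y ≤ 1 is infinitely differentiable on the open interval (0,1). -/
open MeasureTheory Set Filter Topology

/-- sets where a measurable function is large have small measure on bounded intervals -/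
lemma aux_small (f : ℝ → ℝ) (hf : Measurable f) (c d : ℝ) (ε : ENNReal) (hε : 0 < ε) :
    ∃ N : ℕ, ∀ n ≥ N, volume ({t | (n : ℝ) < |f t|} ∩ Icc c d) < ε := by
  have hT : Tendsto (fun n : ℕ => volume ({t | (n : ℝ) < |f t|} ∩ Icc c d)) atTop
      (𝓝 (volume (⋂ n : ℕ, ({t | (n : ℝ) < |f t|} ∩ Icc c d)))) := by
    apply tendsto_measure_iInter_atTop
    · intro n
      exact ((measurableSet_lt measurable_const hf.abs).inter measurableSet_Icc).nullMeasurableSet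
    · intro m n hmn t ht
      refine ⟨?_, ht.2⟩
      have h1 : (n : ℝ) < |f t| := ht.1
      have h2 : (m : ℝ) ≤ n := by exact_mod_cast hmn
      exact lt_of_le_of_lt h2 h1
    · refine ⟨0, ne_of_lt (lt_of_le_of_lt (measure_mono inter_subset_right) ?_)⟩
      simp
  have he : (⋂ n : ℕ, ({t | (n : ℝ) < |f t|} ∩ Icc c d)) = ∅ := by
    ext t
    simp only [mem_iInter, mem_empty_iff_false, iff_false, not_forall]
    obtain ⟨n, hn⟩ := exists_nat_gt |f t|
    exact ⟨n, fun h => absurd h.1 (not_lt.mpr hn.le)⟩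
  rw [he, measure_empty] at hT
  obtain ⟨N, hN⟩ := eventually_atTop.1 (hT.eventually (gt_mem_nhds hε))
  exact ⟨N, hN⟩

lemma aux_bdd (α : ℝ) (hα : 0 < α) (v : ℝ → ℝ) (hv : Measurable v)
    (h : ∀ y w : ℝ, 0 < y → y < w → w < 1 →
      v w = v y + (1 - y) ^ α * v (1 - ((1 - y) / (1 - w))⁻¹) - w ^ α * v (y / w))
    (w₀ : ℝ) (h0 : 0 < w₀) (h1 : w₀ < 1) : ∃ M, ∀ᶠ w in 𝓝 w₀, |v w| ≤ M := by
  have hε : (0 : ENNReal) < ENNReal.ofReal (w₀ / 12) := by simp; positivity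
  obtain ⟨N₁, hN₁⟩ := aux_small v hv 0 1 _ hε
  have hg : Measurable fun s : ℝ => v (1 - s⁻¹) := by fun_prop
  obtain ⟨N₂, hN₂⟩ := aux_small _ hg 1 (2 / (1 - w₀)) _ hε
  set n := max N₁ N₂ with hn
  have hB := hN₁ n (le_max_left _ _)
  have hC := hN₂ n (le_max_right _ _)
  set B := {t | (n : ℝ) < |v t|} ∩ Icc (0:ℝ) 1 with hBdef
  set C := {s : ℝ | (n : ℝ) < |v (1 - s⁻¹)|} ∩ Icc (1:ℝ) (2 / (1 - w₀)) with hCdef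
  refine ⟨3 * n, ?_⟩
  have hnb : Ioo (3 * w₀ / 4) ((1 + w₀) / 2) ∈ 𝓝 w₀ := Ioo_mem_nhds (by linarith) (by linarith)
  filter_upwards [hnb] with w hw
  obtain ⟨hw1, hw2⟩ := hw
  have hwpos : 0 < w := by linarith
  have hwlt : w < 1 := by linarith
  have hxpos : 0 < 1 - w := by linarith
  have key : ∃ y ∈ Icc (w₀ / 4) (w₀ / 2), y ∉ B ∧ y / w ∉ B ∧ (1 - y) / (1 - w) ∉ C := by
    by_contra hcon
    push Not at hcon
    have hsub : Icc (w₀ / 4) (w₀ / 2) ⊆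
        B ∪ ((fun y => y * w⁻¹) ⁻¹' B ∪ (fun y => 1 - y) ⁻¹' ((fun y => y * (1 - w)⁻¹) ⁻¹' C)) := by
      intro y hy
      by_cases hy1 : y ∈ B
      · exact Or.inl hy1
      by_cases hy2 : y / w ∈ B
      · exact Or.inr (Or.inl (by simpa [div_eq_mul_inv] using hy2))
      · have := hcon y hy hy1 hy2
        exact Or.inr (Or.inr (by simpa [div_eq_mul_inv] using this))
    have hv2 : volume ((fun y => y * w⁻¹) ⁻¹' B) ≤ volume B := by
      rw [Real.volume_preimage_mul_right (by positivity), inv_inv, abs_of_pos hwpos]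
      calc _ ≤ 1 * volume B := by
            gcongr
            simpa using hwlt.le
        _ = _ := one_mul _
    have hCm : MeasurableSet C :=
      (measurableSet_lt measurable_const hg.abs).inter measurableSet_Icc
    have hCm' : MeasurableSet ((fun y : ℝ => y * (1 - w)⁻¹) ⁻¹' C) :=
      (measurable_id.mul_const _) hCm
    have hv3 : volume ((fun y => 1 - y) ⁻¹' ((fun y => y * (1 - w)⁻¹) ⁻¹' C)) ≤ volume C := by
      rw [(Measure.measurePreserving_sub_left volume (1:ℝ)).measure_preimage
        hCm'.nullMeasurableSet]
      rw [Real.volume_preimage_mul_right (by positivity), inv_inv, abs_of_pos hxpos]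
      calc _ ≤ 1 * volume C := by
            gcongr
            simpa using hwpos.le
        _ = _ := one_mul _
    have hle := (measure_mono (μ := volume) hsub).trans ((measure_union_le _ _).trans
      (add_le_add le_rfl (measure_union_le _ _)))
    have hlt : volume (Icc (w₀ / 4) (w₀ / 2)) < ENNReal.ofReal (w₀ / 12) +
        (ENNReal.ofReal (w₀ / 12) + ENNReal.ofReal (w₀ / 12)) := by
      refine hle.trans_lt (ENNReal.add_lt_add hB (ENNReal.add_lt_add (hv2.trans_lt hB)
        (hv3.trans_lt hC)))
    rw [Real.volume_Icc, ← ENNReal.ofReal_add (by positivity) (by positivity),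
      ← ENNReal.ofReal_add (by positivity) (by positivity)] at hlt
    have : w₀ / 2 - w₀ / 4 = w₀ / 12 + (w₀ / 12 + w₀ / 12) := by ring
    rw [this] at hlt
    exact lt_irrefl _ hlt
  obtain ⟨y, ⟨hya, hyb⟩, hy1, hy2, hy3⟩ := key
  have hypos : 0 < y := by linarith
  have hyw : y < w := by linarith
  have b1 : |v y| ≤ n := by
    by_contra hc
    exact hy1 ⟨not_le.1 hc, hypos.le, by linarith⟩
  have b2 : |v (y / w)| ≤ n := by
    by_contra hc
    exact hy2 ⟨not_le.1 hc, by positivity, by rw [div_le_one hwpos]; exact hyw.le⟩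
  have b3 : |v (1 - ((1 - y) / (1 - w))⁻¹)| ≤ n := by
    by_contra hc
    refine hy3 ⟨not_le.1 hc, ?_, ?_⟩
    · rw [le_div_iff₀ hxpos]; linarith
    · rw [div_le_div_iff₀ hxpos (by linarith)]
      nlinarith
  have p1 : 0 ≤ (1 - y) ^ α := Real.rpow_nonneg (by linarith) _
  have p2 : (1 - y) ^ α ≤ 1 := Real.rpow_le_one (by linarith) (by linarith) hα.le
  have p3 : 0 ≤ w ^ α := Real.rpow_nonneg hwpos.le _
  have p4 : w ^ α ≤ 1 := Real.rpow_le_one hwpos.le hwlt.le hα.le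
  have hn0 : (0:ℝ) ≤ n := Nat.cast_nonneg n
  have q1 : |(1 - y) ^ α * v (1 - ((1 - y) / (1 - w))⁻¹)| ≤ n := by
    rw [abs_mul, abs_of_nonneg p1]; nlinarith [abs_nonneg (v (1 - ((1 - y) / (1 - w))⁻¹))]
  have q2 : |w ^ α * v (y / w)| ≤ n := by
    rw [abs_mul, abs_of_nonneg p3]; nlinarith [abs_nonneg (v (y / w))]
  rw [h y w hypos hyw hwlt]
  rw [abs_le] at *
  constructor <;> linarith [b1.1, b1.2, q1.1, q1.2, q2.1, q2.2]

lemma aux_int (S : Set ℝ) (hS : S.OrdConnected) (f : ℝ → ℝ) (hf : Measurable f)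
    (hb : ∀ x ∈ S, ∃ M, ∀ᶠ w in 𝓝 x, |f w| ≤ M) {a b : ℝ} (ha : a ∈ S) (hb' : b ∈ S) :
    IntervalIntegrable f volume a b := by
  have hL : LocallyIntegrableOn f (uIcc a b) := by
    intro x hx
    obtain ⟨M, hM⟩ := hb x (hS.uIcc_subset ha hb' hx)
    have : IntegrableAtFilter f (𝓝 x) volume := by
      refine Measure.FiniteAtFilter.integrableAtFilter (l := 𝓝 x) ?_ ?_ ?_
      · exact hf.stronglyMeasurable.stronglyMeasurableAtFilter
      · exact volume.finiteAt_nhds x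
      · exact ⟨M, by simpa using hM⟩
    exact this.filter_mono nhdsWithin_le_nhds
  exact (hL.integrableOn_isCompact isCompact_uIcc).intervalIntegrable

lemma aux_cont (S : Set ℝ) (hS : S.OrdConnected) (hO : IsOpen S) (f : ℝ → ℝ)
    (hi : ∀ a ∈ S, ∀ b ∈ S, IntervalIntegrable f volume a b) (c : ℝ) (hc : c ∈ S) :
    ContinuousOn (fun t => ∫ r in c..t, f r) S := by
  intro x hx
  obtain ⟨ε, hε, hball⟩ := Metric.isOpen_iff.1 hO x hx
  have m1 : x - ε / 2 ∈ S := hball (by rw [Metric.mem_ball, Real.dist_eq, abs_lt]; constructor <;> linarith)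
  have m2 : x + ε / 2 ∈ S := hball (by rw [Metric.mem_ball, Real.dist_eq, abs_lt]; constructor <;> linarith)
  have k1 := intervalIntegral.continuousOn_primitive_interval' (hi _ m1 _ m2) (a := x)
    (by rw [uIcc_of_le (by linarith)]; constructor <;> linarith)
  have k2 : ContinuousAt (fun t => ∫ r in x..t, f r) x :=
    k1.continuousAt (by rw [uIcc_of_le (by linarith)]; exact Icc_mem_nhds (by linarith) (by linarith))
  have k3 : ContinuousAt (fun t => (∫ r in c..x, f r) + ∫ r in x..t, f r) x :=
    continuousAt_const.add k2
  refine ContinuousAt.continuousWithinAt (k3.congr ?_)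
  filter_upwards [hO.mem_nhds hx] with t ht
  exact intervalIntegral.integral_add_adjacent_intervals (hi _ hc _ hx) (hi _ hx _ ht)

lemma aux_succ (S : Set ℝ) (hO : IsOpen S) (f : ℝ → ℝ) (hf : Measurable f)
    (hi : ∀ a ∈ S, ∀ b ∈ S, IntervalIntegrable f volume a b) (c : ℝ) (hc : c ∈ S)
    (n : ℕ) (hn : ContDiffOn ℝ n f S) :
    ContDiffOn ℝ (n + 1 : ℕ) (fun t => ∫ r in c..t, f r) S := by
  have hd : ∀ x ∈ S, HasDerivAt (fun t => ∫ r in c..t, f r) (f x) x := by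
    intro x hx
    exact intervalIntegral.integral_hasDerivAt_right (hi _ hc _ hx)
      hf.stronglyMeasurable.stronglyMeasurableAtFilter
      (hn.continuousOn.continuousAt (hO.mem_nhds hx))
  push_cast
  rw [contDiffOn_succ_iff_deriv_of_isOpen hO]
  refine ⟨fun x hx => (hd x hx).differentiableAt.differentiableWithinAt, by simp, ?_⟩
  exact hn.congr fun x hx => (hd x hx).deriv

lemma aux_repr (α : ℝ) (v : ℝ → ℝ)
    (h : ∀ y w : ℝ, 0 < y → y < w → w < 1 →
      v w = v y + (1 - y) ^ α * v (1 - ((1 - y) / (1 - w))⁻¹) - w ^ α * v (y / w))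
    (hi : ∀ a ∈ Ioo (0:ℝ) 1, ∀ b ∈ Ioo (0:ℝ) 1, IntervalIntegrable v volume a b)
    (hi' : ∀ a ∈ Ioi (1:ℝ), ∀ b ∈ Ioi (1:ℝ),
      IntervalIntegrable (fun s => s ^ α * v (1 - s⁻¹)) volume a b)
    (a b w : ℝ) (ha : 0 < a) (hab : a < b) (hbw : b < w) (hw : w < 1) :
    v w = ((∫ y in a..b, v y) +
      (1 - w) ^ α * ((1 - w) * ((∫ s in (2:ℝ)..(1 - a) / (1 - w), s ^ α * v (1 - s⁻¹)) -
        ∫ s in (2:ℝ)..(1 - b) / (1 - w), s ^ α * v (1 - s⁻¹))) -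
      w ^ α * (w * ((∫ t in (1/2:ℝ)..b / w, v t) - ∫ t in (1/2:ℝ)..a / w, v t))) / (b - a) := by
  have hw0 : 0 < w := by linarith
  have hx0 : 0 < 1 - w := by linarith
  have mA : (1 - a) / (1 - w) ∈ Ioi (1:ℝ) := by
    rw [mem_Ioi, lt_div_iff₀ hx0]; linarith
  have mB : (1 - b) / (1 - w) ∈ Ioi (1:ℝ) := by
    rw [mem_Ioi, lt_div_iff₀ hx0]; linarith
  have ma : a / w ∈ Ioo (0:ℝ) 1 := ⟨by positivity, by rw [div_lt_one hw0]; linarith⟩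
  have mb : b / w ∈ Ioo (0:ℝ) 1 := ⟨div_pos (by linarith) hw0, by rw [div_lt_one hw0]; linarith⟩
  have m2 : (2:ℝ) ∈ Ioi (1:ℝ) := by simp
  have mh : (1/2:ℝ) ∈ Ioo (0:ℝ) 1 := by constructor <;> norm_num
  rw [intervalIntegral.integral_interval_sub_left (hi' _ m2 _ mA) (hi' _ m2 _ mB),
    intervalIntegral.integral_interval_sub_left (hi _ mh _ mb) (hi _ mh _ ma)]
  set g : ℝ → ℝ := fun s => s ^ α * v (1 - s⁻¹) with hg
  have e1 : ∫ y in a..b, v (y / w) = w * ∫ t in a / w..b / w, v t := by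
    rw [intervalIntegral.integral_comp_div _ hw0.ne', smul_eq_mul]
  have e2 : ∫ y in a..b, g ((1 - y) / (1 - w)) =
      (1 - w) * ∫ s in (1 - b) / (1 - w)..(1 - a) / (1 - w), g s := by
    rw [intervalIntegral.integral_comp_sub_left (fun y => g (y / (1 - w))) 1,
      intervalIntegral.integral_comp_div _ hx0.ne', smul_eq_mul]
  have i1 : IntervalIntegrable (fun y => v (y / w)) volume a b := by
    have := (hi _ ma _ mb).comp_mul_right (c := w⁻¹) 
    simpa [div_eq_mul_inv, hw0.ne'] using this
  have i2 : IntervalIntegrable (fun y => g ((1 - y) / (1 - w))) volume a b := by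
    have h1 := (hi' _ mA _ mB).comp_mul_right (c := (1 - w)⁻¹)
    have h2 := h1.comp_sub_left 1
    simpa [div_eq_mul_inv, hx0.ne'] using h2
  have i0 := hi a ⟨ha, by linarith⟩ b ⟨by linarith, by linarith⟩
  have e3 : ∫ y in a..b, v w = ∫ y in a..b, (v y + (1 - w) ^ α * g ((1 - y) / (1 - w)) -
      w ^ α * v (y / w)) := by
    apply intervalIntegral.integral_congr
    intro y hy
    rw [uIcc_of_le hab.le] at hy
    have hy1 : 0 < 1 - y := by linarith [hy.2]
    simp only [hg]
    rw [h y w (by linarith [hy.1]) (by linarith [hy.2]) hw, Real.div_rpow hy1.le hx0.le]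
    have : (1 - w) ^ α ≠ 0 := (Real.rpow_pos_of_pos hx0 _).ne'
    field_simp
  rw [intervalIntegral.integral_const, intervalIntegral.integral_sub
    (i0.add (i2.const_mul _)) (i1.const_mul _), intervalIntegral.integral_add i0 (i2.const_mul _),
    intervalIntegral.integral_const_mul, intervalIntegral.integral_const_mul, e1, e2,
    smul_eq_mul] at e3
  rw [eq_div_iff (by linarith), mul_comm, e3]

lemma aux_reg (α : ℝ) (v : ℝ → ℝ) (F G : ℝ → ℝ) (n : ℕ)
    (hF : ContDiffOn ℝ n F (Ioo 0 1)) (hG : ContDiffOn ℝ n G (Ioi 1))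
    (K : ℝ → ℝ → ℝ)
    (h : ∀ a b w : ℝ, 0 < a → a < b → b < w → w < 1 → v w = (K a b +
      (1 - w) ^ α * ((1 - w) * (G ((1 - a) / (1 - w)) - G ((1 - b) / (1 - w)))) -
      w ^ α * (w * (F (b / w) - F (a / w)))) / (b - a)) :
    ContDiffOn ℝ n v (Ioo 0 1) := by
  intro w₀ hw₀
  obtain ⟨h0, h1⟩ := hw₀
  apply ContDiffAt.contDiffWithinAt
  have hx0 : 0 < 1 - w₀ := by linarith
  have cF : ∀ c : ℝ, 0 < c → c < w₀ → ContDiffAt ℝ n (fun w => F (c / w)) w₀ := by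
    intro c hc hcw
    have hm : c / w₀ ∈ Ioo (0:ℝ) 1 := ⟨by positivity, by rw [div_lt_one h0]; exact hcw⟩
    exact (hF.contDiffAt (isOpen_Ioo.mem_nhds hm)).comp w₀
      (contDiffAt_const.div contDiffAt_id h0.ne')
  have cG : ∀ c : ℝ, 0 < c → c < w₀ → ContDiffAt ℝ n (fun w => G ((1 - c) / (1 - w))) w₀ := by
    intro c hc hcw
    have hm : (1 - c) / (1 - w₀) ∈ Ioi (1:ℝ) := by rw [mem_Ioi, lt_div_iff₀ hx0]; linarith
    exact (hG.contDiffAt (isOpen_Ioi.mem_nhds hm)).comp w₀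
      (contDiffAt_const.div (contDiffAt_const.sub contDiffAt_id) hx0.ne')
  have c1 : ContDiffAt ℝ n (fun w : ℝ => w ^ α) w₀ := Real.contDiffAt_rpow_const_of_ne h0.ne'
  have c2 : ContDiffAt ℝ n (fun w : ℝ => (1 - w) ^ α) w₀ :=
    (contDiffAt_const.sub contDiffAt_id).rpow_const_of_ne hx0.ne'
  have c3 : ContDiffAt ℝ n (fun w : ℝ => 1 - w) w₀ := contDiffAt_const.sub contDiffAt_id
  have hall := ((((contDiffAt_const (c := K (w₀ / 4) (w₀ / 2))).add (c2.mul (c3.mul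
    ((cG (w₀ / 4) (by linarith) (by linarith)).sub (cG (w₀ / 2) (by linarith) (by linarith)))))).sub
    (c1.mul (contDiffAt_id.mul
    ((cF (w₀ / 2) (by linarith) (by linarith)).sub (cF (w₀ / 4) (by linarith) (by linarith)))))).div_const
    (w₀ / 2 - w₀ / 4))
  refine hall.congr_of_eventuallyEq ?_
  filter_upwards [Ioo_mem_nhds (show w₀ / 2 < w₀ by linarith) h1] with w hw
  exact h (w₀ / 4) (w₀ / 2) w (by linarith) (by linarith) hw.1 hw.2

/-- For `α > 0`, any Lebesgue-measurable solution `u : [0,1] → ℝ` of the fundamental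
functional equation is infinitely differentiable on `(0,1)`. -/
theorem stmt2 (α : ℝ) (hα : 0 < α) (u : ℝ → ℝ)
    (hmeas : Measurable fun x : Set.Icc (0 : ℝ) 1 => u x)
    (heq : ∀ x y : ℝ, 0 ≤ x → x < 1 → 0 ≤ y → y < 1 → x + y ≤ 1 →
      u (1 - x) + (1 - x) ^ α * u (y / (1 - x))
        = u y + (1 - y) ^ α * u ((1 - x - y) / (1 - y))) :
    ContDiffOn ℝ (⊤ : ℕ∞) u (Set.Ioo 0 1) := by
  classical
  set v : ℝ → ℝ := (Icc (0:ℝ) 1).indicator u with hvdef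
  have huv : ∀ t, 0 ≤ t → t ≤ 1 → v t = u t := 
    fun t h0 h1 => indicator_of_mem (s := Icc (0:ℝ) 1) ⟨h0, h1⟩ u
  have hv : Measurable v := by
    refine measurable_of_restrict_of_restrict_compl (s := Icc (0:ℝ) 1) measurableSet_Icc ?_ ?_
    · have : (Icc (0:ℝ) 1).domRestrict v = fun x : Icc (0:ℝ) 1 => u x := by
        ext x
        exact huv x x.2.1 x.2.2
      rw [this]
      exact hmeas
    · have : (Icc (0:ℝ) 1)ᶜ.domRestrict v = fun _ => 0 := by
        ext x
        exact indicator_of_notMem x.2 u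
      rw [this]
      exact measurable_const
  have h : ∀ y w : ℝ, 0 < y → y < w → w < 1 →
      v w = v y + (1 - y) ^ α * v (1 - ((1 - y) / (1 - w))⁻¹) - w ^ α * v (y / w) := by
    intro y w hy hyw hw
    have hw0 : 0 < w := by linarith
    have hy1 : 0 < 1 - y := by linarith
    have e := heq (1 - w) y (by linarith) (by linarith) hy.le (by linarith) (by linarith)
    have e1 : 1 - ((1 - y) / (1 - w))⁻¹ = (1 - (1 - w) - y) / (1 - y) := by
      rw [inv_div]; field_simp; ring
    rw [e1, huv w hw0.le hw.le, huv y hy.le (by linarith), huv (y / w) (by positivity)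
      (by rw [div_le_one hw0]; exact hyw.le), huv _ (div_nonneg (by linarith) hy1.le)
      (by rw [div_le_one hy1]; linarith)]
    rw [sub_sub_cancel] at e ⊢
    linarith
  have hb : ∀ x ∈ Ioo (0:ℝ) 1, ∃ M, ∀ᶠ w in 𝓝 x, |v w| ≤ M :=
    fun x hx => aux_bdd α hα v hv h x hx.1 hx.2
  have hmem : ∀ s : ℝ, 1 < s → 1 - s⁻¹ ∈ Ioo (0:ℝ) 1 := by
    intro s hs
    have h1 : s⁻¹ < 1 := inv_lt_one_of_one_lt₀ hs
    have h2 : 0 < s⁻¹ := by positivity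
    constructor <;> linarith
  set g : ℝ → ℝ := fun s => s ^ α * v (1 - s⁻¹) with hg
  have hgm : Measurable g := by
    have : Measurable fun s : ℝ => v (1 - s⁻¹) := by fun_prop
    exact (measurable_id.pow_const α).mul this
  have hgb : ∀ x ∈ Ioi (1:ℝ), ∃ M, ∀ᶠ w in 𝓝 x, |g w| ≤ M := by
    intro x hx
    have hx0 : (0:ℝ) < x := by have : (1:ℝ) < x := hx; linarith
    obtain ⟨M, hM⟩ := hb _ (hmem x hx)
    have ct : ContinuousAt (fun s : ℝ => 1 - s⁻¹) x :=
      continuousAt_const.sub (continuousAt_inv₀ hx0.ne')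
    have cp : ContinuousAt (fun s : ℝ => |s ^ α|) x :=
      (Real.continuousAt_rpow_const x α (Or.inl hx0.ne')).abs
    refine ⟨(|x ^ α| + 1) * M, ?_⟩
    filter_upwards [ct.eventually hM, cp.eventually (gt_mem_nhds (lt_add_one _))] with w h1 h2
    rw [hg, abs_mul]
    exact mul_le_mul h2.le h1 (abs_nonneg _) (by positivity)
  have hi : ∀ a ∈ Ioo (0:ℝ) 1, ∀ b ∈ Ioo (0:ℝ) 1, IntervalIntegrable v volume a b :=
    fun a ha b hb' => aux_int _ ordConnected_Ioo v hv hb ha hb'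
  have hi' : ∀ a ∈ Ioi (1:ℝ), ∀ b ∈ Ioi (1:ℝ), IntervalIntegrable g volume a b :=
    fun a ha b hb' => aux_int _ ordConnected_Ioi g hgm hgb ha hb'
  have m2 : (2:ℝ) ∈ Ioi (1:ℝ) := by simp
  have mh : (1/2:ℝ) ∈ Ioo (0:ℝ) 1 := by constructor <;> norm_num
  have hrep := aux_repr α v h hi hi'
  have main : ∀ n : ℕ, ContDiffOn ℝ n v (Ioo 0 1) := by
    intro n
    induction n with
    | zero =>
      refine aux_reg α v (fun t => ∫ r in (1/2:ℝ)..t, v r) (fun t => ∫ r in (2:ℝ)..t, g r) 0 ?_ ?_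
        (fun a b => ∫ y in a..b, v y) hrep
      · exact_mod_cast contDiffOn_zero.2 (aux_cont _ ordConnected_Ioo isOpen_Ioo v hi _ mh)
      · exact_mod_cast contDiffOn_zero.2 (aux_cont _ ordConnected_Ioi isOpen_Ioi g hi' _ m2)
    | succ n ih =>
      refine aux_reg α v (fun t => ∫ r in (1/2:ℝ)..t, v r) (fun t => ∫ r in (2:ℝ)..t, g r) (n + 1)
        ?_ ?_ (fun a b => ∫ y in a..b, v y) hrep
      · exact aux_succ _ isOpen_Ioo v hv hi _ mh n ih
      · refine aux_succ _ isOpen_Ioi g hgm hi' _ m2 n ?_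
        have hne : ∀ s ∈ Ioi (1:ℝ), s ≠ 0 := fun s hs => by
          have : (1:ℝ) < s := hs
          linarith
        refine ContDiffOn.mul (contDiffOn_id.rpow_const_of_ne hne) ?_
        exact ih.comp (contDiffOn_const.sub (contDiffOn_id.inv hne)) (fun s hs => hmem s hs)
  rw [contDiffOn_infty]
  intro n
  exact (main n).congr fun x hx => (huv x hx.1.le hx.2.le).symm
end
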